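/- Let A be a finite union-closed family of subsets of a finite universe U, and let S ⊆ U be minimal (under inclusion) with the property that every nonempty member-set of A intersects S. Then {T ∩ S : T ∈ A} equals the full power set of S; consequently |A| ≥ 2^{|S|}. -/

import Mathlib

theorem minimal_hitting_set_trace {α : Type*} [DecidableEq α]
    (A : Finset (Finset α))
    (hUC : ∀ B ∈ A, ∀ C ∈ A, B ∪ C ∈ A)
    (hempty : ∅ ∈ A) (hne : ∃ T ∈ A, T.Nonempty)
    (S : Finset α) (hSU : S ⊆ A.biUnion id)
    (hhit : ∀ T ∈ A, T.Nonempty → (T ∩ S).Nonempty)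
    (hmin : ∀ S' : Finset α, S' ⊂ S → ∃ T ∈ A, T.Nonempty ∧ T ∩ S' = ∅) :
    A.image (fun T => T ∩ S) = S.powerset ∧ 2 ^ S.card ≤ A.card := by
  have hsingleton : ∀ s ∈ S, ∃ T ∈ A, T ∩ S = {s} := by
    intro s hs
    obtain ⟨T, hTA, hT, hdisj⟩ := hmin (S.erase s) (Finset.erase_ssubset hs)
    refine ⟨T, hTA, (hhit T hTA hT).subset_singleton_iff.mp fun x hx => ?_⟩
    rw [Finset.mem_inter] at hx
    by_contra hxs
    have hmem : x ∈ T ∩ S.erase s :=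
      Finset.mem_inter.mpr ⟨hx.1, Finset.mem_erase.mpr ⟨by simpa using hxs, hx.2⟩⟩
    simp [hdisj] at hmem
  have htrace : ∀ R : Finset α, R ⊆ S → ∃ T ∈ A, T ∩ S = R := by
    intro R
    induction R using Finset.induction_on with
    | empty => exact fun _ => ⟨∅, hempty, Finset.empty_inter S⟩
    | insert s R _ ih =>
      intro hR
      obtain ⟨hs, hRS⟩ := Finset.insert_subset_iff.mp hR
      obtain ⟨B, hB, hBs⟩ := hsingleton s hs
      obtain ⟨C, hC, hCR⟩ := ih hRS
      exact ⟨B ∪ C, hUC B hB C hC, by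
        rw [Finset.union_inter_distrib_right, hBs, hCR, Finset.insert_eq]⟩
  have himage : A.image (fun T => T ∩ S) = S.powerset := by
    ext R
    simp only [Finset.mem_image, Finset.mem_powerset]
    exact ⟨fun ⟨T, _, hT⟩ => hT ▸ Finset.inter_subset_right, htrace R⟩
  refine ⟨himage, ?_⟩
  rw [← Finset.card_powerset, ← himage]
  exact Finset.card_image_le
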